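/- Every finitely generated projective module of rank one over the group ring Z[Z/6Z] ≅ Z[T]/(T⁶ - 1) is free; equivalently, Pic(Z[T]/(T⁶ - 1)) = 0. -/

import Mathlib

open Polynomial TensorProduct

/-- The integral group ring of the cyclic group of order 6, `ℤ[T]/(T⁶ - 1)`. -/
abbrev RingT6sub1 : Type := ℤ[X] ⧸ Ideal.span {(X : ℤ[X]) ^ 6 - 1}

namespace Module.Invertible

variable {R : Type*} [CommRing R] (M : Type*) [AddCommGroup M] [Module R M] [Module.Invertible R M]

theorem exists_span_singleton_sup_smul_top_eq_top (I : Ideal R)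
    [Subsingleton (CommRing.Pic (R ⧸ I))] :
    ∃ m : M, Submodule.span R {m} ⊔ I • (⊤ : Submodule R M) = ⊤ := by
  obtain ⟨e⟩ := (free_iff_linearEquiv (R := R ⧸ I) (M := (R ⧸ I) ⊗[R] M)).mp inferInstance
  let E : (M ⧸ I • (⊤ : Submodule R M)) ≃ₗ[R] R ⧸ I :=
    (TensorProduct.quotTensorEquivQuotSMul M I).symm ≪≫ₗ e.restrictScalars R
  obtain ⟨m, hm⟩ := Submodule.mkQ_surjective _ (E.symm 1)
  refine ⟨m, eq_top_iff.mpr fun x _ ↦ ?_⟩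
  obtain ⟨r, hr⟩ := Ideal.Quotient.mk_surjective (E (Submodule.mkQ _ x))
  have h : Submodule.mkQ (I • (⊤ : Submodule R M)) x = r • Submodule.mkQ _ m := by
    apply E.injective
    rw [hm, map_smul, E.apply_symm_apply, ← hr, Algebra.smul_def, mul_one]
    rfl
  rw [← map_smul, ← sub_eq_zero, ← map_sub] at h
  exact Submodule.mem_sup.mpr ⟨r • m, Submodule.mem_span_singleton.mpr ⟨r, rfl⟩, x - r • m,
    (Submodule.Quotient.mk_eq_zero _).mp h, by abel⟩

theorem mem_of_forall_smul_mem_smul_top {I : Ideal R} {c : R}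
    (h : ∀ m : M, c • m ∈ I • (⊤ : Submodule R M)) : c ∈ I := by
  have key (t : Module.Dual R M ⊗[R] M) : c * contractLeft R M t ∈ I := by
    induction t with
    | zero => simp
    | add x y hx hy => simpa [mul_add] using add_mem hx hy
    | tmul φ m =>
      have := Submodule.mem_map_of_mem (f := φ) (h m)
      rw [Submodule.map_smul''] at this
      have hle : I • Submodule.map φ ⊤ ≤ I := Ideal.mul_le_left
      simpa using hle this
  obtain ⟨t, ht⟩ := (linearEquiv R M).surjective 1
  have hc := key t
  rwa [show contractLeft R M t = 1 from ht, mul_one] at hc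

theorem free_of_units_surjective {I J : Ideal R} (hIJ : I * J = ⊥)
    [Subsingleton (CommRing.Pic (R ⧸ I))] [Subsingleton (CommRing.Pic (R ⧸ J))]
    (hu : ∀ r s : R, r * s - 1 ∈ I ⊔ J → ∃ u : R, IsUnit u ∧ r - u ∈ I ⊔ J) :
    Module.Free R M := by
  obtain ⟨a, ha⟩ := exists_span_singleton_sup_smul_top_eq_top M I
  obtain ⟨b, hb⟩ := exists_span_singleton_sup_smul_top_eq_top M J
  have exists_smul {K : Ideal R} {c : M}
      (hc : Submodule.span R {c} ⊔ K • (⊤ : Submodule R M) = ⊤) (x : M) :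
      ∃ r : R, x - r • c ∈ K • (⊤ : Submodule R M) := by
    obtain ⟨_, hy, z, hz, rfl⟩ := Submodule.mem_sup.mp (hc ▸ Submodule.mem_top (x := x))
    obtain ⟨r, rfl⟩ := Submodule.mem_span_singleton.mp hy
    exact ⟨r, by simpa using hz⟩
  have hI : I • (⊤ : Submodule R M) ≤ (I ⊔ J) • ⊤ := Submodule.smul_mono_left le_sup_left
  have hJ : J • (⊤ : Submodule R M) ≤ (I ⊔ J) • ⊤ := Submodule.smul_mono_left le_sup_right
  obtain ⟨r, hr⟩ := exists_smul hb a
  obtain ⟨s, hs⟩ := exists_smul ha b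
  have hrs : r * s - 1 ∈ I ⊔ J := by
    refine mem_of_forall_smul_mem_smul_top M fun x ↦ ?_
    obtain ⟨t, ht⟩ := exists_smul hb x
    have hsr : (r * s - 1) • b ∈ (I ⊔ J) • (⊤ : Submodule R M) := by
      have := add_mem (Submodule.smul_mem _ s (hJ hr)) (hI hs)
      rw [← neg_mem_iff]
      convert this using 1
      module
    convert add_mem (Submodule.smul_mem _ (r * s - 1) (hJ ht)) (Submodule.smul_mem _ t hsr) using 1
    module
  obtain ⟨u, huu, hru⟩ := hu r s hrs
  have hab : a - u • b ∈ I • (⊤ : Submodule R M) ⊔ J • ⊤ := by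
    rw [← Submodule.sup_smul]
    convert add_mem (hJ hr) (Submodule.smul_mem_smul hru (Submodule.mem_top (x := b))) using 1
    module
  obtain ⟨x, hx, y, hy, hxy⟩ := Submodule.mem_sup.mp hab
  obtain ⟨m, hm⟩ : ∃ m, m = a - x := ⟨_, rfl⟩
  have hmI : Submodule.span R {m} ⊔ I • (⊤ : Submodule R M) = ⊤ := by
    refine eq_top_iff.mpr (ha.ge.trans (sup_le ?_ le_sup_right))
    rw [Submodule.span_singleton_le_iff_mem]
    exact Submodule.mem_sup.mpr ⟨m, Submodule.mem_span_singleton_self m, x, hx, by simp [hm]⟩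
  have hmJ : Submodule.span R {m} ⊔ J • (⊤ : Submodule R M) = ⊤ := by
    refine eq_top_iff.mpr (hb.ge.trans (sup_le ?_ le_sup_right))
    rw [← Submodule.span_singleton_smul_eq huu b, Submodule.span_singleton_le_iff_mem]
    refine Submodule.mem_sup.mpr ⟨m, Submodule.mem_span_singleton_self m, -y, neg_mem hy, ?_⟩
    rw [hm, eq_sub_of_add_eq' hxy]
    abel
  have hspan : Submodule.span R {m} = ⊤ := by
    have hle : I • (⊤ : Submodule R M) ≤ Submodule.span R {m} :=
      calc I • (⊤ : Submodule R M) = I • (Submodule.span R {m} ⊔ J • ⊤) := by rw [hmJ]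
        _ = I • Submodule.span R {m} := by
          rw [Submodule.smul_sup, ← Submodule.mul_smul, hIJ, Submodule.bot_smul, sup_bot_eq]
        _ ≤ Submodule.span R {m} := Submodule.smul_le_right
    rwa [sup_eq_left.mpr hle] at hmI
  exact free_iff_linearEquiv.mpr ⟨(LinearEquiv.ofBijective (LinearMap.toSpanSingleton R M m)
    (bijective_of_surjective (LinearMap.range_eq_top.mp
      (by rw [LinearMap.range_toSpanSingleton, hspan])))).symm⟩

end Module.Invertible

namespace CommRing.Pic

theorem subsingleton_of_ringEquiv {R S : Type*} [CommRing R] [CommRing S] (e : R ≃+* S)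
    [Subsingleton (Pic S)] : Subsingleton (Pic R) := by
  refine Function.Injective.subsingleton (f := mapRingHom (e : R →+* S)) ?_
  refine Function.LeftInverse.injective (g := mapRingHom (e.symm : S →+* R)) fun M ↦ ?_
  rw [mapRingHom_mapRingHom, RingEquiv.symm_comp, mapRingHom_id_apply]

/-- If `R` surjects onto `A` and `B` with kernels `I` and `J` satisfying `I * J = 0`, if every unit
of `R ⧸ (I ⊔ J)` lifts to a unit of `R`, and if `A` and `B` have trivial Picard group, then so does
`R`. -/
theorem subsingleton_of_units_surjective {R A B : Type*} [CommRing R] [CommRing A] [CommRing B]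
    [Subsingleton (Pic A)] [Subsingleton (Pic B)] {f : R →+* A} {g : R →+* B}
    (hf : Function.Surjective f) (hg : Function.Surjective g)
    (hfg : RingHom.ker f * RingHom.ker g = ⊥)
    (hu : ∀ r s : R, r * s - 1 ∈ RingHom.ker f ⊔ RingHom.ker g →
      ∃ u : R, IsUnit u ∧ r - u ∈ RingHom.ker f ⊔ RingHom.ker g) :
    Subsingleton (Pic R) := by
  have := subsingleton_of_ringEquiv (RingHom.quotientKerEquivOfSurjective hf)
  have := subsingleton_of_ringEquiv (RingHom.quotientKerEquivOfSurjective hg)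
  exact subsingleton_iff.mpr fun M _ _ _ ↦ Module.Invertible.free_of_units_surjective M hfg hu

end CommRing.Pic

theorem mul_eq_bot_of_forall_dvd {F G H : ℤ[X]} (hH : H = F * G)
    {I J : Ideal (ℤ[X] ⧸ Ideal.span {H})}
    (hI : ∀ p : ℤ[X], Ideal.Quotient.mk _ p ∈ I → F ∣ p)
    (hJ : ∀ p : ℤ[X], Ideal.Quotient.mk _ p ∈ J → G ∣ p) : I * J = ⊥ := by
  rw [eq_bot_iff, Ideal.mul_le]
  intro r hr s hs
  obtain ⟨p, rfl⟩ := Ideal.Quotient.mk_surjective r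
  obtain ⟨q, rfl⟩ := Ideal.Quotient.mk_surjective s
  rw [← map_mul, Ideal.mem_bot, Ideal.Quotient.eq_zero_iff_dvd, hH]
  exact mul_dvd_mul (hI p hr) (hJ q hs)

open NumberField in
theorem subsingleton_pic_X_pow_three_sub_one :
    Subsingleton (CommRing.Pic (ℤ[X] ⧸ Ideal.span {(X : ℤ[X]) ^ 3 - 1})) := by
  let K := CyclotomicField 3 ℚ
  have hK : IsCyclotomicExtension {3} ℚ K := by
    convert CyclotomicField.isCyclotomicExtension 3 ℚ
    · rfl
    · exact Subsingleton.elim (α := Algebra ℚ K) _ _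
  have := IsCyclotomicExtension.Rat.three_pid K
  have hfac : (X : ℤ[X]) ^ 3 - 1 = (X - 1) * (X ^ 2 + X + 1) := by ring
  have hζ := IsCyclotomicExtension.zeta_spec 3 ℚ K
  obtain ⟨ω, hω⟩ : ∃ ω, ω = hζ.toInteger := ⟨_, rfl⟩
  have hmin : minpoly ℤ ω = X ^ 2 + X + 1 := by
    rw [← cyclotomic_three, cyclotomic_eq_minpoly hζ (by norm_num), hω]
    exact (RingOfIntegers.minpoly_coe hζ.toInteger).symm
  have hω0 : ω ^ 2 + ω + 1 = 0 := by
    simpa [hmin] using minpoly.aeval ℤ ω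
  let f : (ℤ[X] ⧸ Ideal.span {(X : ℤ[X]) ^ 3 - 1}) →+* ℤ :=
    Ideal.Quotient.lift _ (evalRingHom 1) fun p hp ↦ by
      obtain ⟨q, rfl⟩ := Ideal.mem_span_singleton.mp hp
      simp
  let g : (ℤ[X] ⧸ Ideal.span {(X : ℤ[X]) ^ 3 - 1}) →+* 𝓞 K :=
    Ideal.Quotient.lift _ (aeval ω).toRingHom fun p hp ↦ by
      obtain ⟨q, rfl⟩ := Ideal.mem_span_singleton.mp hp
      simp [hfac, hω0]
  have hf (p : ℤ[X]) : f (Ideal.Quotient.mk _ p) = p.eval 1 := rfl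
  have hg (p : ℤ[X]) : g (Ideal.Quotient.mk _ p) = aeval ω p := rfl
  refine CommRing.Pic.subsingleton_of_units_surjective (f := f) (g := g)
    (fun n ↦ ⟨Ideal.Quotient.mk _ (C n), by simp⟩) (fun x ↦ ?_) ?_ ?_
  · have hx : x ∈ Algebra.adjoin ℤ {ω} := by
      rw [hω, IsCyclotomicExtension.Rat.adjoin_singleton_eq_top hζ]
      trivial
    rw [Algebra.adjoin_singleton_eq_range_aeval] at hx
    obtain ⟨p, hp⟩ := hx
    exact ⟨Ideal.Quotient.mk _ p, hp⟩
  · refine mul_eq_bot_of_forall_dvd hfac (fun p hp ↦ ?_) (fun p hp ↦ ?_)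
    · rw [RingHom.mem_ker, hf] at hp
      simpa using dvd_iff_isRoot.mpr hp
    · rw [RingHom.mem_ker, hg] at hp
      rw [← hmin]
      exact minpoly.isIntegrallyClosed_dvd (Algebra.IsIntegral.isIntegral ω) hp
  · intro r s hrs
    obtain ⟨p, rfl⟩ := Ideal.Quotient.mk_surjective r
    obtain ⟨q, rfl⟩ := Ideal.Quotient.mk_surjective s
    let h : (ℤ[X] ⧸ Ideal.span {(X : ℤ[X]) ^ 3 - 1}) →+* ZMod 3 :=
      (Int.castRingHom (ZMod 3)).comp f
    have hker : RingHom.ker f ⊔ RingHom.ker g ≤ RingHom.ker h := by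
      refine sup_le (fun x hx ↦ ?_) (fun x hx ↦ ?_)
      · simp only [h, RingHom.mem_ker, RingHom.comp_apply] at hx ⊢
        simp [hx]
      · obtain ⟨t, rfl⟩ := Ideal.Quotient.mk_surjective x
        rw [RingHom.mem_ker, hg] at hx
        obtain ⟨t, rfl⟩ := hmin ▸
          minpoly.isIntegrallyClosed_dvd (Algebra.IsIntegral.isIntegral ω) hx
        have h3 : (3 : ZMod 3) = 0 := by decide
        simp only [h, RingHom.mem_ker, RingHom.comp_apply, hf]
        norm_num
        exact Or.inl h3
    have h3 : (3 : ℤ[X] ⧸ Ideal.span {(X : ℤ[X]) ^ 3 - 1}) ∈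
        RingHom.ker f ⊔ RingHom.ker g := by
      refine Submodule.mem_sup.mpr ⟨Ideal.Quotient.mk _ (3 - (X ^ 2 + X + 1)), ?_,
        Ideal.Quotient.mk _ (X ^ 2 + X + 1), ?_, ?_⟩
      · rw [RingHom.mem_ker, hf]; simp
      · rw [RingHom.mem_ker, hg]; simp [hω0]
      · rw [← map_add, sub_add_cancel]; rfl
    have hunit := hker hrs
    simp only [RingHom.mem_ker, map_sub, map_mul, map_one, sub_eq_zero] at hunit
    have key : ∀ x y : ZMod 3, x * y = 1 → x = (1 : ℤ) ∨ x = (-1 : ℤ) := by decide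
    have hε : ∃ ε : ℤ, IsUnit ε ∧ ((p.eval 1 : ℤ) : ZMod 3) = ε := by
      rcases key _ _ hunit with h1 | h1
      · exact ⟨1, isUnit_one, h1⟩
      · exact ⟨-1, isUnit_one.neg, h1⟩
    obtain ⟨ε, hε, hpε⟩ := hε
    obtain ⟨k, hk⟩ := (ZMod.intCast_eq_intCast_iff_dvd_sub _ _ 3).mp hpε.symm
    refine ⟨(ε : ℤ), hε.map (Int.castRingHom _), ?_⟩
    have h1 : Ideal.Quotient.mk _ p - ((p.eval 1 : ℤ) : _) ∈ RingHom.ker f := by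
      rw [RingHom.mem_ker, map_sub, map_intCast, hf]; simp
    have h2 : ((p.eval 1 : ℤ) : ℤ[X] ⧸ Ideal.span {(X : ℤ[X]) ^ 3 - 1}) - (ε : ℤ) =
        3 * (k : ℤ) := by
      rw [← Int.cast_sub, hk]
      push_cast
      rfl
    rw [← sub_add_sub_cancel _ ((p.eval 1 : ℤ) : ℤ[X] ⧸ Ideal.span {(X : ℤ[X]) ^ 3 - 1}), h2]
    exact add_mem (Ideal.mem_sup_left h1) (Ideal.mul_mem_right _ _ h3)

theorem exists_eq_add_X_pow_three_sub_one_mul (p : ℤ[X]) : ∃ (a b c : ℤ) (t : ℤ[X]),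
    p = C a + C b * X + C c * X ^ 2 + (X ^ 3 - 1) * t := by
  have hmonic : (X ^ 3 - 1 : ℤ[X]).Monic := monic_X_pow_sub_C 1 three_ne_zero
  have hd : (X ^ 3 - 1 : ℤ[X]).natDegree = 3 := natDegree_X_pow_sub_C (r := (1 : ℤ))
  have hdeg : (p %ₘ (X ^ 3 - 1)).natDegree < 3 :=
    (natDegree_modByMonic_lt p hmonic (fun h ↦ by simp [h] at hd)).trans_eq hd
  refine ⟨(p %ₘ (X ^ 3 - 1)).coeff 0, (p %ₘ (X ^ 3 - 1)).coeff 1,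
    (p %ₘ (X ^ 3 - 1)).coeff 2, p /ₘ (X ^ 3 - 1), ?_⟩
  conv_lhs => rw [← modByMonic_add_div p (X ^ 3 - 1), as_sum_range_C_mul_X_pow' _ hdeg]
  simp [Finset.sum_range_succ]

theorem subsingleton_pic_X_pow_six_sub_one : Subsingleton (CommRing.Pic RingT6sub1) := by
  have := subsingleton_pic_X_pow_three_sub_one
  have hfac : (X : ℤ[X]) ^ 6 - 1 = (X ^ 3 - 1) * (X ^ 3 + 1) := by ring
  let f : RingT6sub1 →+* ℤ[X] ⧸ Ideal.span {(X : ℤ[X]) ^ 3 - 1} :=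
    Ideal.Quotient.factor (Ideal.span_singleton_le_span_singleton.mpr ⟨_, hfac⟩)
  let g : RingT6sub1 →+* ℤ[X] ⧸ Ideal.span {(X : ℤ[X]) ^ 3 - 1} :=
    Ideal.Quotient.lift _ ((Ideal.Quotient.mk _).comp (compRingHom (-X))) fun p hp ↦ by
      obtain ⟨q, rfl⟩ := Ideal.mem_span_singleton.mp hp
      rw [RingHom.comp_apply, Ideal.Quotient.eq_zero_iff_dvd]
      refine ⟨(X ^ 3 + 1) * q.comp (-X), ?_⟩
      simp only [coe_compRingHom_apply, mul_comp, sub_comp, pow_comp, X_comp, one_comp]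
      ring
  have hf (p : ℤ[X]) : f (Ideal.Quotient.mk _ p) = Ideal.Quotient.mk _ p := rfl
  have hg (p : ℤ[X]) : g (Ideal.Quotient.mk _ p) = Ideal.Quotient.mk _ (p.comp (-X)) := rfl
  have hkerf (p : ℤ[X]) : Ideal.Quotient.mk _ p ∈ RingHom.ker f ↔ X ^ 3 - 1 ∣ p := by
    rw [RingHom.mem_ker, hf, Ideal.Quotient.eq_zero_iff_dvd]
  have hkerg (p : ℤ[X]) : Ideal.Quotient.mk _ p ∈ RingHom.ker g ↔ X ^ 3 + 1 ∣ p := by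
    rw [RingHom.mem_ker, hg, Ideal.Quotient.eq_zero_iff_dvd]
    constructor
    · rintro ⟨t, ht⟩
      refine ⟨-t.comp (-X), ?_⟩
      have := congrArg (fun q : ℤ[X] ↦ q.comp (-X)) ht
      simp only [comp_assoc, neg_comp, X_comp, neg_neg, comp_X, mul_comp, sub_comp, pow_comp,
        one_comp] at this
      rw [this]
      ring
    · rintro ⟨t, rfl⟩
      refine ⟨-t.comp (-X), ?_⟩
      simp only [mul_comp, add_comp, pow_comp, X_comp, one_comp]
      ring
  refine CommRing.Pic.subsingleton_of_units_surjective (f := f) (g := g)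
    (fun x ↦ ?_) (fun x ↦ ?_) ?_ ?_
  · obtain ⟨p, rfl⟩ := Ideal.Quotient.mk_surjective x
    exact ⟨Ideal.Quotient.mk _ p, hf p⟩
  · obtain ⟨p, rfl⟩ := Ideal.Quotient.mk_surjective x
    exact ⟨Ideal.Quotient.mk _ (p.comp (-X)), by simp [hg, comp_assoc]⟩
  · exact mul_eq_bot_of_forall_dvd hfac (fun p ↦ (hkerf p).mp) (fun p ↦ (hkerg p).mp)
  · intro r s hrs
    obtain ⟨p, rfl⟩ := Ideal.Quotient.mk_surjective r
    obtain ⟨q, rfl⟩ := Ideal.Quotient.mk_surjective s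
    let P : Matrix (Fin 3) (Fin 3) (ZMod 2) := !![0, 0, 1; 1, 0, 0; 0, 1, 0]
    have hP1 : P ^ 3 - 1 = 0 := by decide
    have hP2 : P ^ 3 + 1 = 0 := by decide
    have hP (t : ℤ[X]) (ht : Ideal.Quotient.mk _ t ∈ RingHom.ker f ⊔ RingHom.ker g) :
        aeval P t = 0 := by
      obtain ⟨x, hx, y, hy, hxy⟩ := Submodule.mem_sup.mp ht
      obtain ⟨x, rfl⟩ := Ideal.Quotient.mk_surjective x
      obtain ⟨y, rfl⟩ := Ideal.Quotient.mk_surjective y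
      obtain ⟨x, rfl⟩ := (hkerf x).mp hx
      obtain ⟨y, rfl⟩ := (hkerg y).mp hy
      rw [← map_add, eq_comm, Ideal.Quotient.mk_eq_mk_iff_sub_mem, Ideal.mem_span_singleton,
        hfac] at hxy
      obtain ⟨z, hz⟩ := hxy
      rw [eq_add_of_sub_eq hz]
      simp [hP1, hP2]
    obtain ⟨a, b, c, t, rfl⟩ := exists_eq_add_X_pow_three_sub_one_mul p
    have hmul := hP ((C a + C b * X + C c * X ^ 2 + (X ^ 3 - 1) * t) * q - 1) (by simpa using hrs)
    have hdet : ((a : Matrix (Fin 3) (Fin 3) (ZMod 2)) + b * P + c * P ^ 2).det ≠ 0 := by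
      intro h0
      have := congrArg Matrix.det (sub_eq_zero.mp ((map_sub _ _ _).symm.trans hmul))
      simp [hP1, h0] at this
    have key : ∀ a b c : ZMod 2, (!![a, c, b; b, a, c; c, b, a]).det ≠ 0 →
        (a = (1 : ℤ) ∧ b = (0 : ℤ) ∧ c = (0 : ℤ)) ∨ (a = (0 : ℤ) ∧ b = (1 : ℤ) ∧ c = (0 : ℤ)) ∨
        (a = (0 : ℤ) ∧ b = (0 : ℤ) ∧ c = (1 : ℤ)) := by decide
    have hmat : (a : Matrix (Fin 3) (Fin 3) (ZMod 2)) + b * P + c * P ^ 2 =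
        !![(a : ZMod 2), c, b; b, a, c; c, b, a] := by
      have hsmul : ∀ x y z : ZMod 2,
          x • 1 + y • P + z • P ^ 2 = !![x, z, y; y, x, z; z, y, x] := by decide
      rw [← hsmul, Int.cast_smul_eq_zsmul, Int.cast_smul_eq_zsmul, Int.cast_smul_eq_zsmul,
        zsmul_one, zsmul_eq_mul, zsmul_eq_mul]
    have hunit : IsUnit (Ideal.Quotient.mk (Ideal.span {(X : ℤ[X]) ^ 6 - 1}) X) := by
      refine IsUnit.of_pow_eq_one (n := 6) ?_ (by norm_num)
      rw [← sub_eq_zero, ← map_pow, ← map_one (Ideal.Quotient.mk _), ← map_sub,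
        Ideal.Quotient.eq_zero_iff_dvd]
    have hmem {a' b' c' : ℤ} (ha : (a : ZMod 2) = a') (hb : (b : ZMod 2) = b')
        (hc : (c : ZMod 2) = c') :
        Ideal.Quotient.mk (Ideal.span {(X : ℤ[X]) ^ 6 - 1})
          (C a + C b * X + C c * X ^ 2 + (X ^ 3 - 1) * t) -
        Ideal.Quotient.mk _ (C a' + C b' * X + C c' * X ^ 2) ∈ RingHom.ker f ⊔ RingHom.ker g := by
      obtain ⟨k, hk⟩ := (ZMod.intCast_eq_intCast_iff_dvd_sub _ _ 2).mp ha.symm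
      obtain ⟨l, hl⟩ := (ZMod.intCast_eq_intCast_iff_dvd_sub _ _ 2).mp hb.symm
      obtain ⟨m, hm⟩ := (ZMod.intCast_eq_intCast_iff_dvd_sub _ _ 2).mp hc.symm
      rw [sub_eq_iff_eq_add] at hk hl hm
      subst hk hl hm
      refine Submodule.mem_sup.mpr
        ⟨Ideal.Quotient.mk _ ((X ^ 3 - 1) * (t - (C k + C l * X + C m * X ^ 2))),
          (hkerf _).mpr ⟨_, rfl⟩,
          Ideal.Quotient.mk _ ((X ^ 3 + 1) * (C k + C l * X + C m * X ^ 2)),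
          (hkerg _).mpr ⟨_, rfl⟩, ?_⟩
      rw [← map_add, ← map_sub]
      congr 1
      simp only [map_add, map_mul, Nat.cast_ofNat, map_ofNat]
      ring
    rcases key a b c (hmat ▸ hdet) with ⟨ha, hb, hc⟩ | ⟨ha, hb, hc⟩ | ⟨ha, hb, hc⟩
    · exact ⟨1, isUnit_one, by simpa using hmem ha hb hc⟩
    · exact ⟨_, hunit, by simpa using hmem ha hb hc⟩
    · exact ⟨_, hunit.pow 2, by simpa using hmem ha hb hc⟩

/-- Every finitely generated projective module of rank one (i.e. invertible
module) over `ℤ[ℤ/6ℤ] ≅ ℤ[T]/(T⁶ - 1)` is free; equivalently `Pic(ℤ[T]/(T⁶ - 1)) = 0`. -/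
theorem stmt5 (M : Type) [AddCommGroup M] [Module RingT6sub1 M]
    [Module.Finite RingT6sub1 M] [Module.Projective RingT6sub1 M]
    (hinv : ∃ (N : Type) (_ : AddCommGroup N) (_ : Module RingT6sub1 N),
      Nonempty ((M ⊗[RingT6sub1] N) ≃ₗ[RingT6sub1] RingT6sub1)) :
    Module.Free RingT6sub1 M := by
  obtain ⟨N, _, _, ⟨e⟩⟩ := hinv
  have := Module.Invertible.left e
  have := subsingleton_pic_X_pow_six_sub_one
  infer_instance
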